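/- arXiv:2303.16271 — 7 statements merged into one kernel-verified Lean document; each statement's English description precedes it below -/
import Mathlib

section
/- Let R be a commutative ring with distinguished elements A, Q, T such that Q, 1−Q and 1−T are invertible, and assume moreover that the intersection of the ideals T^N·R over all N ≥ 1 is zero. If p and p̃ are two column families over (R; A, Q, T) such that p_σ(v, w) = p̃_σ(v, w) whenever at least one of the strings v, w is empty, then p_σ(v, w) = p̃_σ(v, w) for all binary strings v, w with |v| = |w| = l and all σ ∈ S_l. (In other words, the column relations uniquely determine the family from its values at inputs in which one string is empty.) -/
noncomputable section

/-- The cycle `X_l ∈ S_l` with (1-indexed) `X_l(1) = l` and `X_l(i) = i - 1` for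
`2 ≤ i ≤ l`; in 0-indexed terms it sends `0 ↦ l-1` and `i ↦ i-1` for `1 ≤ i ≤ l-1`. -/
def Xcycle (l : ℕ) : Equiv.Perm (Fin l) := (finRotate l)⁻¹

/-- The natural inclusion `S_l ↪ S_{l+1}` fixing the last strand `l+1`. -/
def inclPerm {l : ℕ} (σ : Equiv.Perm (Fin l)) : Equiv.Perm (Fin (l + 1)) :=
  finSuccEquivLast.permCongr.symm σ.optionCongr

/-- The map `Tr_{l+1} : S_{l+1} → S_l`, given by `Tr(σ)(i) = σ(i)` if `σ(i) ≠ l+1` and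
`Tr(σ)(i) = σ(l+1)` if `σ(i) = l+1`. -/
def trPerm {l : ℕ} (σ : Equiv.Perm (Fin (l + 1))) : Equiv.Perm (Fin l) :=
  Equiv.removeNone (finSuccEquivLast.permCongr σ)

/-- A *column family* over `(R; A, Q, T)`.  Binary strings are `List Bool`
(`true` is `1`, `false` is `0`), the number of ones of `v` is `v.count true`, and
`p l v w σ` is the value of the family at the pair `(v, w)` with `|v| = |w| = l`
and `σ ∈ S_l`.  The seven fields are the column relations (1)–(7). -/
structure ColumnFamily (R : Type*) [CommRing R] (A Q T : R) where
  p : (l : ℕ) → List Bool → List Bool → Equiv.Perm (Fin l) → R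
  rel1 : ∀ m n : ℕ,
    p 1 (List.replicate m false ++ [true]) (List.replicate n false ++ [true]) 1 =
      (1 + A) * Ring.inverse (1 - Q) * Ring.inverse (1 - T) *
        p 0 (List.replicate m false) (List.replicate n false) 1
  rel2 : ∀ (l : ℕ) (v w : List Bool) (σ : Equiv.Perm (Fin (l + 1))),
    1 ≤ l → v.count true = l → w.count true = l → σ (Fin.last l) = Fin.last l →
    p (l + 1) (v ++ [true]) (w ++ [true]) σ =
      (Q ^ l + A) * Ring.inverse (1 - Q) * p l v w (trPerm σ)
  rel3 : ∀ (l : ℕ) (v w : List Bool) (σ : Equiv.Perm (Fin (l + 1))),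
    1 ≤ l → v.count true = l → w.count true = l → σ (Fin.last l) ≠ Fin.last l →
    p (l + 1) (v ++ [true]) (w ++ [true]) σ = (Q ^ l + A) * p l v w (trPerm σ)
  rel4 : ∀ (l : ℕ) (v w : List Bool) (σ : Equiv.Perm (Fin (l + 1))),
    v.count true = l + 1 → w.count true = l →
    p (l + 1) (v ++ [false]) (w ++ [true]) σ =
      p (l + 1) v (true :: w) (σ * Xcycle (l + 1))
  rel5 : ∀ (l : ℕ) (v w : List Bool) (σ : Equiv.Perm (Fin (l + 1))),
    v.count true = l → w.count true = l + 1 →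
    p (l + 1) (v ++ [true]) (w ++ [false]) σ =
      p (l + 1) (true :: v) w (Xcycle (l + 1) * σ)
  rel6 : ∀ m n : ℕ,
    p 0 (List.replicate (m + 1) false) (List.replicate (n + 1) false) 1 =
      p 1 (true :: List.replicate m false) (true :: List.replicate n false) 1
  rel7 : ∀ (l : ℕ) (v w : List Bool) (σ : Equiv.Perm (Fin (l + 1))),
    v.count true = l + 1 → w.count true = l + 1 →
    p (l + 1) (v ++ [false]) (w ++ [false]) σ =
      Ring.inverse (Q ^ (l + 1)) * p (l + 2) (true :: v) (true :: w) (inclPerm σ) +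
        Ring.inverse (Q ^ (l + 1)) * T * p (l + 1) (false :: v) (false :: w) σ

theorem eq_replicate_false_of_count_true_eq_zero {v : List Bool} {n : ℕ} (hn : v.length = n)
    (hv : v.count true = 0) : v = List.replicate n false := by
  refine List.eq_replicate_iff.2 ⟨hn, fun b hb => ?_⟩
  cases b
  · rfl
  · exact absurd hb (List.count_eq_zero.1 hv)

/-- Two column families that agree whenever one of the strings is empty agree everywhere.
The relations terminate: each one shortens the strings, or adds a `1`, or rotates a `0` off the
end of the first string. -/
theorem ColumnFamily.p_eq_of_forall_nil {R : Type*} [CommRing R] {A Q T : R}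
    (P P' : ColumnFamily R A Q T)
    (hbase : ∀ (l : ℕ) (v w : List Bool) (σ : Equiv.Perm (Fin l)),
      v.count true = l → w.count true = l → v = [] ∨ w = [] →
      P.p l v w σ = P'.p l v w σ)
    (l : ℕ) (v w : List Bool) (σ : Equiv.Perm (Fin l))
    (hv : v.count true = l) (hw : w.count true = l) : P.p l v w σ = P'.p l v w σ := by
  rcases List.eq_nil_or_concat' v with rfl | ⟨v, a, rfl⟩
  · exact hbase l _ _ σ hv hw (Or.inl rfl)
  rcases List.eq_nil_or_concat' w with rfl | ⟨w, b, rfl⟩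
  · exact hbase l _ _ σ hv hw (Or.inr rfl)
  rcases l with _ | l
  · obtain ⟨m, hm⟩ : ∃ m, v ++ [a] = List.replicate (m + 1) false :=
      ⟨v.length, eq_replicate_false_of_count_true_eq_zero (by simp) hv⟩
    obtain ⟨n, hn⟩ : ∃ n, w ++ [b] = List.replicate (n + 1) false :=
      ⟨w.length, eq_replicate_false_of_count_true_eq_zero (by simp) hw⟩
    rw [hm, hn, Subsingleton.elim σ 1, P.rel6, P'.rel6]
    exact P.p_eq_of_forall_nil P' hbase 1 _ _ 1 (by simp [List.count_replicate])
      (by simp [List.count_replicate])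
  cases a <;> cases b <;> simp only [List.count_append, List.count_singleton_self,
    List.count_singleton, Nat.add_right_cancel_iff, beq_iff_eq, Bool.false_eq_true, if_false,
    Nat.add_zero] at hv hw
  · have hmem : true ∈ v := List.count_pos_iff.1 (by omega)
    have hrot : (false :: v).reverse.idxOf true < (v ++ [false]).reverse.idxOf true := by
      simp [List.idxOf_append, hmem, List.idxOf_cons_ne]
    rw [P.rel7 l v w σ hv hw, P'.rel7 l v w σ hv hw,
      P.p_eq_of_forall_nil P' hbase (l + 2) (true :: v) (true :: w) _ (by simp [hv]) (by simp [hw]),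
      P.p_eq_of_forall_nil P' hbase (l + 1) (false :: v) (false :: w) _ (by simp [hv])
        (by simp [hw])]
  · rw [P.rel4 l v w σ hv hw, P'.rel4 l v w σ hv hw]
    exact P.p_eq_of_forall_nil P' hbase (l + 1) _ _ _ hv (by simp [hw])
  · rw [P.rel5 l v w σ hv hw, P'.rel5 l v w σ hv hw]
    exact P.p_eq_of_forall_nil P' hbase (l + 1) _ _ _ (by simp [hv]) hw
  · rcases Nat.eq_zero_or_pos l with rfl | hl
    · have ih := P.p_eq_of_forall_nil P' hbase 0 v w 1 hv hw
      rw [eq_replicate_false_of_count_true_eq_zero rfl hv,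
        eq_replicate_false_of_count_true_eq_zero rfl hw] at ih ⊢
      rw [Subsingleton.elim (α := Equiv.Perm (Fin 1)) σ 1, P.rel1, P'.rel1, ih]
    · have ih := P.p_eq_of_forall_nil P' hbase l v w (trPerm σ) hv hw
      by_cases hσ : σ (Fin.last l) = Fin.last l
      · rw [P.rel2 l v w σ hl hv hw hσ, P'.rel2 l v w σ hl hv hw hσ, ih]
      · rw [P.rel3 l v w σ hl hv hw hσ, P'.rel3 l v w σ hl hv hw hσ, ih]
termination_by (v.length + w.length, v.count false, v.reverse.idxOf true)
decreasing_by
  all_goals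
    subst_vars
    simp_all [Prod.lex_def, -List.reverse_cons, -List.reverse_append]
  all_goals omega

/-- The column relations uniquely determine the family from its values at inputs in
which at least one of the two strings is empty. -/
theorem columnFamily_unique {R : Type*} [CommRing R] {A Q T : R}
    (hQ : IsUnit Q) (hQ1 : IsUnit (1 - Q)) (hT1 : IsUnit (1 - T))
    (hTadic : ∀ x : R, (∀ N : ℕ, 1 ≤ N → ∃ r : R, x = T ^ N * r) → x = 0)
    (P P' : ColumnFamily R A Q T)
    (hbase : ∀ (l : ℕ) (v w : List Bool) (σ : Equiv.Perm (Fin l)),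
      v.count true = l → w.count true = l → v = [] ∨ w = [] →
      P.p l v w σ = P'.p l v w σ) :
    ∀ (l : ℕ) (v w : List Bool) (σ : Equiv.Perm (Fin l)),
      v.count true = l → w.count true = l → P.p l v w σ = P'.p l v w σ := by
  exact P.p_eq_of_forall_nil P' hbase

end
end

section
/- Let R be a commutative ring with distinguished elements A, Q, T such that Q, 1−Q and 1−T are invertible, and let p be a column family over (R; A, Q, T) with p_e(∅, ∅) = 1 (where ∅ denotes the empty string). Then for every k ≥ 1, p_e(1^k, 1^k) = (1+A)·(1−Q)^{-1}·(1−T)^{-1}·∏_{i=2}^{k} (Q^{i−1} + A)·(1−Q)^{-1}, where 1^k denotes the string of k ones. (This is the un-normalized graded dimension of the y-ified exterior-power-colored homology of the unknot.) -/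
noncomputable section

/-- The closure of the last strand of the identity braid is the identity. -/
theorem trPerm_one (l : ℕ) : trPerm (1 : Equiv.Perm (Fin (l + 1))) = 1 := by
  have h : finSuccEquivLast.permCongr (1 : Equiv.Perm (Fin (l + 1))) =
      Equiv.optionCongr (Equiv.refl (Fin l)) := by
    ext x
    simp [Equiv.permCongr_apply]
  rw [trPerm, h, Equiv.removeNone_optionCongr]
  rfl

/-- The value of a (normalized) column family at `(1^k, 1^k)`: the un-normalized graded
dimension of the y-ified `⋀^k`-colored homology of the unknot. -/
theorem columnFamily_colored_unknot {R : Type*} [CommRing R] {A Q T : R}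
    (hQ : IsUnit Q) (hQ1 : IsUnit (1 - Q)) (hT1 : IsUnit (1 - T))
    (P : ColumnFamily R A Q T) (hnorm : P.p 0 [] [] 1 = 1)
    (k : ℕ) (hk : 1 ≤ k) :
    P.p k (List.replicate k true) (List.replicate k true) 1 =
      (1 + A) * Ring.inverse (1 - Q) * Ring.inverse (1 - T) *
        ∏ i ∈ Finset.Icc 2 k, ((Q ^ (i - 1) + A) * Ring.inverse (1 - Q)) := by
  induction k, hk using Nat.le_induction with
  | base => simpa [hnorm] using P.rel1 0 0
  | succ k hk ih =>
    have h := P.rel2 k (List.replicate k true) (List.replicate k true) 1 hk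
      (by simp) (by simp) rfl
    rw [← List.replicate_succ', trPerm_one, ih] at h
    rw [h, Finset.prod_Icc_succ_top (by omega), Nat.add_sub_cancel]
    ring

end
end

section
/- Let R be a commutative ring with distinguished elements A, Q, T such that Q, 1−Q and 1−T are invertible, and let p be a column family over (R; A, Q, T) with p_e(∅, ∅) = 1 (where ∅ denotes the empty string). Then p_e(00, 00) = (1+A)·(Q + A + T − Q·T)·Q^{-1}·(1−Q)^{-2}·(1−T)^{-2}. (This is the un-normalized graded dimension of the y-ified HOMFLYPT homology of the positive Hopf link T(2,2).) -/
noncomputable section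

/-- The value of a (normalized) column family at `(00, 00)`: the un-normalized graded
dimension of the y-ified HOMFLYPT homology of the positive Hopf link `T(2,2)`. -/
theorem columnFamily_hopf_link {R : Type*} [CommRing R] {A Q T : R}
    (hQ : IsUnit Q) (hQ1 : IsUnit (1 - Q)) (hT1 : IsUnit (1 - T))
    (P : ColumnFamily R A Q T) (hnorm : P.p 0 [] [] 1 = 1) :
    P.p 0 [false, false] [false, false] 1 =
      (1 + A) * (Q + A + T - Q * T) * Ring.inverse Q *
        Ring.inverse (1 - Q) ^ 2 * Ring.inverse (1 - T) ^ 2 := by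
  have h_unknot : P.p 1 [true] [true] 1 =
      (1 + A) * Ring.inverse (1 - Q) * Ring.inverse (1 - T) := by
    simpa [hnorm] using P.rel1 0 0
  have h_fixed : (inclPerm (1 : Equiv.Perm (Fin 1))) (Fin.last 1) = Fin.last 1 := by
    simp [inclPerm, Equiv.permCongr]
  have h_full : P.p 2 [true, true] [true, true] (inclPerm 1) =
      (Q + A) * Ring.inverse (1 - Q) * P.p 1 [true] [true] 1 := by
    have h := P.rel2 1 [true] [true] (inclPerm 1) le_rfl rfl rfl h_fixed
    rwa [Subsingleton.elim (trPerm (inclPerm 1)) 1, pow_one] at h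
  have h_zero : P.p 0 [false] [false] 1 = P.p 1 [true] [true] 1 := P.rel6 0 0
  have h_shift : P.p 1 [false, true] [false, true] 1 =
      (1 + A) * Ring.inverse (1 - Q) * Ring.inverse (1 - T) * P.p 0 [false] [false] 1 :=
    P.rel1 1 1
  have h_split : P.p 1 [true, false] [true, false] 1 =
      Ring.inverse Q * P.p 2 [true, true] [true, true] (inclPerm 1) +
        Ring.inverse Q * T * P.p 1 [false, true] [false, true] 1 := by
    simpa using P.rel7 0 [true] [true] 1 rfl rfl
  have h_open : P.p 0 [false, false] [false, false] 1 =
      P.p 1 [true, false] [true, false] 1 := P.rel6 1 1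
  rw [h_open, h_split, h_full, h_shift, h_zero, h_unknot]
  linear_combination (-(Ring.inverse Q * (Q + A) * (1 + A) * Ring.inverse (1 - Q) ^ 2 *
    Ring.inverse (1 - T))) * Ring.mul_inverse_cancel _ hT1

end
end

section
/- (Gaussian Elimination.) Let 𝒜 be an additive category, let A, B₁, B₂, D, E, F be objects of 𝒜, and let α : A → B₁, β : A → D, φ : B₁ → B₂, κ : D → B₂, γ : B₁ → E, ε : D → E, ρ : B₂ → F, ψ : E → F be morphisms such that φ is an isomorphism and the four-term sequence X : A → B₁ ⊕ D → B₂ ⊕ E → F, whose differentials are (α, β)ᵗ, the 2×2 matrix [[φ, κ], [γ, ε]], and (ρ, ψ), is a cochain complex (consecutive composites are zero). Then the four-term sequence Y : A →(β) D →(ε − γφ⁻¹κ) E →(ψ) F is also a cochain complex, and the degreewise morphisms given by id_A, the projection (0, id_D) : B₁⊕D → D, the map (−γφ⁻¹, id_E) : B₂⊕E → E, and id_F define a chain map X → Y, while id_A, (−φ⁻¹κ, id_D)ᵗ : D → B₁⊕D, (0, id_E)ᵗ : E → B₂⊕E, and id_F define a chain map Y → X; these two chain maps form a strong deformation retraction from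 X to Y: the composite Y → X → Y is the identity, and the composite X → Y → X is homotopic to the identity of X. -/
open CategoryTheory CategoryTheory.Limits

/-- **Gaussian elimination.**  Given a four-term cochain complex
`X : A → B₁ ⊞ D → B₂ ⊞ E → F` with differentials `(α, β)ᵗ`, `[[φ, κ], [γ, ε]]`, `(ρ, ψ)`
in which `φ` is an isomorphism, the four-term sequence
`Y : A → D → E → F` with differentials `β`, `ε - γφ⁻¹κ`, `ψ` is a cochain complex, the
indicated degreewise morphisms are chain maps `X → Y` and `Y → X`, and they form a
strong deformation retraction from `X` to `Y`. -/
theorem gaussian_elimination {𝒜 : Type*} [Category 𝒜] [Preadditive 𝒜]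
    [HasBinaryBiproducts 𝒜] {A B₁ B₂ D E F : 𝒜}
    (α : A ⟶ B₁) (β : A ⟶ D) (φ : B₁ ⟶ B₂) (κ : D ⟶ B₂)
    (γ : B₁ ⟶ E) (ε : D ⟶ E) (ρ : B₂ ⟶ F) (ψ : E ⟶ F) [IsIso φ]
    (hX₁ : biprod.lift α β ≫ biprod.desc (biprod.lift φ γ) (biprod.lift κ ε) = 0)
    (hX₂ : biprod.desc (biprod.lift φ γ) (biprod.lift κ ε) ≫ biprod.desc ρ ψ = 0) :
    -- `Y` is a cochain complex
    (β ≫ (ε - κ ≫ inv φ ≫ γ) = 0) ∧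
    ((ε - κ ≫ inv φ ≫ γ) ≫ ψ = 0) ∧
    -- `π = (𝟙 A, (0, 𝟙 D), (-γφ⁻¹, 𝟙 E), 𝟙 F)` is a chain map `X → Y`
    (biprod.lift α β ≫ (biprod.snd : B₁ ⊞ D ⟶ D) = 𝟙 A ≫ β) ∧
    (biprod.desc (biprod.lift φ γ) (biprod.lift κ ε) ≫ biprod.desc (-(inv φ ≫ γ)) (𝟙 E) =
      (biprod.snd : B₁ ⊞ D ⟶ D) ≫ (ε - κ ≫ inv φ ≫ γ)) ∧
    (biprod.desc ρ ψ ≫ 𝟙 F = biprod.desc (-(inv φ ≫ γ)) (𝟙 E) ≫ ψ) ∧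
    -- `ι = (𝟙 A, (-φ⁻¹κ, 𝟙 D)ᵗ, (0, 𝟙 E)ᵗ, 𝟙 F)` is a chain map `Y → X`
    (β ≫ biprod.lift (-(κ ≫ inv φ)) (𝟙 D) = 𝟙 A ≫ biprod.lift α β) ∧
    ((ε - κ ≫ inv φ ≫ γ) ≫ (biprod.inr : E ⟶ B₂ ⊞ E) =
      biprod.lift (-(κ ≫ inv φ)) (𝟙 D) ≫ biprod.desc (biprod.lift φ γ) (biprod.lift κ ε)) ∧
    (ψ ≫ 𝟙 F = (biprod.inr : E ⟶ B₂ ⊞ E) ≫ biprod.desc ρ ψ) ∧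
    -- the composite `Y → X → Y` is the identity
    (𝟙 A ≫ 𝟙 A = 𝟙 A) ∧
    (biprod.lift (-(κ ≫ inv φ)) (𝟙 D) ≫ (biprod.snd : B₁ ⊞ D ⟶ D) = 𝟙 D) ∧
    ((biprod.inr : E ⟶ B₂ ⊞ E) ≫ biprod.desc (-(inv φ ≫ γ)) (𝟙 E) = 𝟙 E) ∧
    (𝟙 F ≫ 𝟙 F = 𝟙 F) ∧
    -- the composite `X → Y → X` is homotopic to the identity of `X`
    (∃ (h₁ : B₁ ⊞ D ⟶ A) (h₂ : B₂ ⊞ E ⟶ B₁ ⊞ D) (h₃ : F ⟶ B₂ ⊞ E),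
      (biprod.lift α β ≫ h₁ = 𝟙 A - 𝟙 A ≫ 𝟙 A) ∧
      (h₁ ≫ biprod.lift α β + biprod.desc (biprod.lift φ γ) (biprod.lift κ ε) ≫ h₂ =
        𝟙 (B₁ ⊞ D) - (biprod.snd : B₁ ⊞ D ⟶ D) ≫ biprod.lift (-(κ ≫ inv φ)) (𝟙 D)) ∧
      (h₂ ≫ biprod.desc (biprod.lift φ γ) (biprod.lift κ ε) + biprod.desc ρ ψ ≫ h₃ =
        𝟙 (B₂ ⊞ E) - biprod.desc (-(inv φ ≫ γ)) (𝟙 E) ≫ (biprod.inr : E ⟶ B₂ ⊞ E)) ∧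
      (h₃ ≫ biprod.desc ρ ψ = 𝟙 F - 𝟙 F ≫ 𝟙 F)) := by
  have h₁ : α ≫ φ + β ≫ κ = 0 := by
    simpa [biprod.lift_desc] using hX₁ =≫ biprod.fst
  have h₂ : α ≫ γ + β ≫ ε = 0 := by
    simpa [biprod.lift_desc] using hX₁ =≫ biprod.snd
  have h₃ : φ ≫ ρ + γ ≫ ψ = 0 := by
    simpa [biprod.lift_desc] using biprod.inl ≫= hX₂
  have h₄ : κ ≫ ρ + ε ≫ ψ = 0 := by
    simpa [biprod.lift_desc] using biprod.inr ≫= hX₂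
  have hα : α = -(β ≫ κ ≫ inv φ) := by
    rw [← cancel_mono φ]
    simpa using eq_neg_of_add_eq_zero_left h₁
  have hρ : ρ = -(inv φ ≫ γ ≫ ψ) := by
    rw [← cancel_epi φ]
    simpa using eq_neg_of_add_eq_zero_left h₃
  clear hX₁ hX₂
  subst hα hρ
  refine ⟨?_, ?_, by simp, ?_, ?_, ?_, ?_, by simp, by simp, by simp, by simp, by simp,
    0, biprod.fst ≫ inv φ ≫ biprod.inl, 0, by simp, ?_, ?_, by simp⟩
  · simpa [sub_eq_neg_add] using h₂
  · simpa [sub_eq_neg_add] using h₄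
  · ext <;> simp [biprod.lift_desc, sub_eq_neg_add]
  · ext <;> simp
  · ext <;> simp
  · ext <;> simp [biprod.lift_desc, sub_eq_neg_add]
  · ext <;> simp
  · ext <;> simp
end

section
/- (Homotopy Perturbation Lemma.) Let R be a ring and let X and Y be cochain complexes of R-modules indexed by ℤ. Suppose given chain maps f : X → Y and g : Y → X and degree −1 graded maps h = (hᵢ : Xⁱ → Xⁱ⁻¹) and k = (kᵢ : Yⁱ → Yⁱ⁻¹) such that d_X∘h + h∘d_X = id_X − g∘f and d_Y∘k + k∘d_Y = id_Y − f∘g. Let α = (αᵢ : Xⁱ → Xⁱ⁺¹) be a degree +1 graded map satisfying the Maurer–Cartan equation d_X∘α + α∘d_X + α∘α = 0 (so that d_X + α is again a differential on the underlying graded module of X), and assume that the degree 0 graded endomorphism id_X + α∘h of X is invertible (then id_X + h∘α is invertible as well). Define β := f∘α∘(id_X + h∘α)⁻¹∘g, F := f∘(id_X + α∘h)⁻¹, G := (id_X + h∘α)⁻¹∘g, and H := h∘(id_X + α∘h)⁻¹. Then: (i) β satisfies the Maurer–Cartan equation d_Y∘β + β∘d_Y + β∘β = 0, so d_Y + β is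 a differential on the underlying graded module of Y; (ii) F and G are chain maps between the perturbed complexes (X, d_X + α) and (Y, d_Y + β); (iii) (d_X + α)∘H + H∘(d_X + α) = id_X − G∘F; and (iv) F∘G is homotopic to id_Y with respect to the differential d_Y + β. In particular F and G are mutually inverse homotopy equivalences between (X, d_X + α) and (Y, d_Y + β). -/
noncomputable section

variable {R : Type*} [Ring R] {X Y : ℤ → Type*}
  [∀ i, AddCommGroup (X i)] [∀ i, Module R (X i)]
  [∀ i, AddCommGroup (Y i)] [∀ i, Module R (Y i)]

/-- The perturbed differential `β := f ∘ α ∘ (id + h∘α)⁻¹ ∘ g`, where `v` is the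
inverse of the degree `0` graded map `id + h∘α`. -/
def hptBeta (f : ∀ i, X i →ₗ[R] Y i) (g : ∀ i, Y i →ₗ[R] X i)
    (α : ∀ i, X i →ₗ[R] X (i + 1)) (v : ∀ i, X i →ₗ[R] X i) (i : ℤ) :
    Y i →ₗ[R] Y (i + 1) :=
  (f (i + 1)).comp ((α i).comp ((v i).comp (g i)))

/-- `F := f ∘ (id + α∘h)⁻¹`, where `u` is the inverse of `id + α∘h`. -/
def hptF (f : ∀ i, X i →ₗ[R] Y i) (u : ∀ i, X (i + 1) →ₗ[R] X (i + 1)) (i : ℤ) :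
    X (i + 1) →ₗ[R] Y (i + 1) :=
  (f (i + 1)).comp (u i)

/-- `G := (id + h∘α)⁻¹ ∘ g`, where `v` is the inverse of `id + h∘α`. -/
def hptG (g : ∀ i, Y i →ₗ[R] X i) (v : ∀ i, X i →ₗ[R] X i) (i : ℤ) :
    Y i →ₗ[R] X i :=
  (v i).comp (g i)

/-- `H := h ∘ (id + α∘h)⁻¹`, where `u` is the inverse of `id + α∘h`. -/
def hptH (h : ∀ i, X (i + 1) →ₗ[R] X i) (u : ∀ i, X (i + 1) →ₗ[R] X (i + 1)) (i : ℤ) :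
    X (i + 1) →ₗ[R] X i :=
  (h i).comp (u i)

/-- A family indexed by successors of integers extends to all integers. -/
theorem exists_family_shift {M : ℤ → Type*} (a : ∀ i, M (i + 1)) :
    ∃ b : ∀ i, M i, ∀ i, b (i + 1) = a i :=
  ⟨(Equiv.addRight (1 : ℤ)).piCongrLeft M a,
    fun i => (Equiv.addRight (1 : ℤ)).piCongrLeft_apply_apply M a i⟩

/-- If `F' ∘ G` is homotopic to the identity through `L` and `G ∘ F` is homotopic to the identity
through `H`, then `F ∘ G` is homotopic to the identity through `L ∘ (id - F∘G) + F' ∘ H ∘ G`. -/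
theorem homotopy_id_of_left_inverse
    (dX : ∀ i, X i →ₗ[R] X (i + 1)) (dY : ∀ i, Y i →ₗ[R] Y (i + 1))
    (F F' : ∀ i, X i →ₗ[R] Y i) (G : ∀ i, Y i →ₗ[R] X i)
    (hF : ∀ i x, dY i (F i x) = F (i + 1) (dX i x))
    (hF' : ∀ i x, dY i (F' i x) = F' (i + 1) (dX i x))
    (hG : ∀ i y, dX i (G i y) = G (i + 1) (dY i y))
    (H : ∀ i, X (i + 1) →ₗ[R] X i) (L : ∀ i, Y (i + 1) →ₗ[R] Y i)
    (hH : ∀ i x, dX i (H i x) + H (i + 1) (dX (i + 1) x) = x - G (i + 1) (F (i + 1) x))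
    (hL : ∀ i y, dY i (L i y) + L (i + 1) (dY (i + 1) y) = y - F' (i + 1) (G (i + 1) y))
    (i : ℤ) (y : Y (i + 1)) :
    dY i (L i (y - F (i + 1) (G (i + 1) y)) + F' i (H i (G (i + 1) y))) +
        (L (i + 1) (dY (i + 1) y - F (i + 1 + 1) (G (i + 1 + 1) (dY (i + 1) y))) +
          F' (i + 1) (H (i + 1) (G (i + 1 + 1) (dY (i + 1) y)))) =
      y - F (i + 1) (G (i + 1) y) := by
  have e₁ := hL i (y - F (i + 1) (G (i + 1) y))
  have e₂ := congrArg (F' (i + 1)) (hH i (G (i + 1) y))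
  simp only [map_add, map_sub, hF, hF', hG] at e₁ e₂ ⊢
  grind

/-- **Homotopy Perturbation Lemma.**  Degree `s` graded maps between ℤ-indexed cochain
complexes of `R`-modules are presented as families so that all composites typecheck:
degree `+1` maps as `∀ i, X i →ₗ X (i+1)` and degree `-1` maps as `∀ i, X (i+1) →ₗ X i`
(each equation below, quantified over all `i : ℤ`, expresses the corresponding identity
in every degree). -/
theorem homotopy_perturbation_lemma
    (dX : ∀ i, X i →ₗ[R] X (i + 1)) (dY : ∀ i, Y i →ₗ[R] Y (i + 1))
    (hdX : ∀ (i : ℤ) (x : X i), dX (i + 1) (dX i x) = 0)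
    (hdY : ∀ (i : ℤ) (y : Y i), dY (i + 1) (dY i y) = 0)
    (f : ∀ i, X i →ₗ[R] Y i) (g : ∀ i, Y i →ₗ[R] X i)
    (hf : ∀ (i : ℤ) (x : X i), f (i + 1) (dX i x) = dY i (f i x))
    (hg : ∀ (i : ℤ) (y : Y i), g (i + 1) (dY i y) = dX i (g i y))
    (h : ∀ i, X (i + 1) →ₗ[R] X i) (k : ∀ i, Y (i + 1) →ₗ[R] Y i)
    (hh : ∀ (i : ℤ) (x : X (i + 1)),
      dX i (h i x) + h (i + 1) (dX (i + 1) x) = x - g (i + 1) (f (i + 1) x))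
    (hk : ∀ (i : ℤ) (y : Y (i + 1)),
      dY i (k i y) + k (i + 1) (dY (i + 1) y) = y - f (i + 1) (g (i + 1) y))
    (α : ∀ i, X i →ₗ[R] X (i + 1))
    (hα : ∀ (i : ℤ) (x : X i),
      dX (i + 1) (α i x) + α (i + 1) (dX i x) + α (i + 1) (α i x) = 0)
    -- `u` is a two-sided inverse of the degree 0 graded map `id + α∘h`
    (u : ∀ i, X (i + 1) →ₗ[R] X (i + 1))
    (hu₁ : ∀ (i : ℤ) (x : X (i + 1)), u i (x + α i (h i x)) = x)
    (hu₂ : ∀ (i : ℤ) (x : X (i + 1)), u i x + α i (h i (u i x)) = x)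
    -- `v` is a two-sided inverse of the degree 0 graded map `id + h∘α`
    (v : ∀ i, X i →ₗ[R] X i)
    (hv₁ : ∀ (i : ℤ) (x : X i), v i (x + h i (α i x)) = x)
    (hv₂ : ∀ (i : ℤ) (x : X i), v i x + h i (α i (v i x)) = x) :
    -- (i) `β` satisfies the Maurer–Cartan equation
    (∀ (i : ℤ) (y : Y i),
      dY (i + 1) (hptBeta f g α v i y) + hptBeta f g α v (i + 1) (dY i y) +
        hptBeta f g α v (i + 1) (hptBeta f g α v i y) = 0) ∧
    -- (ii) `F` and `G` are chain maps between the perturbed complexes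
    (∀ (i : ℤ) (x : X (i + 1)),
      dY (i + 1) (hptF f u i x) + hptBeta f g α v (i + 1) (hptF f u i x) =
        hptF f u (i + 1) (dX (i + 1) x + α (i + 1) x)) ∧
    (∀ (i : ℤ) (y : Y i),
      dX i (hptG g v i y) + α i (hptG g v i y) =
        hptG g v (i + 1) (dY i y + hptBeta f g α v i y)) ∧
    -- (iii) `(d_X + α)∘H + H∘(d_X + α) = id_X − G∘F`
    (∀ (i : ℤ) (x : X (i + 1)),
      dX i (hptH h u i x) + α i (hptH h u i x) +
          hptH h u (i + 1) (dX (i + 1) x + α (i + 1) x) =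
        x - hptG g v (i + 1) (hptF f u i x)) ∧
    -- (iv) `F∘G` is homotopic to `id_Y` with respect to `d_Y + β`
    (∃ L : ∀ i, Y (i + 1) →ₗ[R] Y i,
      ∀ (i : ℤ) (y : Y (i + 1)),
        dY i (L i y) + hptBeta f g α v i (L i y) +
            L (i + 1) (dY (i + 1) y + hptBeta f g α v (i + 1) y) =
          y - hptF f u i (hptG g v (i + 1) y)) := by
  obtain ⟨w, hw⟩ := exists_family_shift (M := fun i => X i →ₗ[R] X i) u
  obtain rfl : (fun i => w (i + 1)) = u := funext hw
  simp only [hptBeta, hptF, hptG, hptH, LinearMap.comp_apply] at *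
  have hwα : ∀ i (x : X i), w (i + 1) (α i x) = α i (v i x) := fun i x => by
    have e := hu₁ i (α i (v i x))
    rwa [← map_add, hv₂] at e
  have hG : ∀ i (y : Y i), dX i (v i (g i y)) + α i (v i (g i y)) =
      v (i + 1) (g (i + 1) (dY i y + f (i + 1) (α i (v i (g i y))))) := fun i y => by
    rw [← hv₁ (i + 1) (dX i (v i (g i y)) + α i (v i (g i y)))]
    congr 1
    have e₁ := congrArg (h (i + 1)) (hα i (v i (g i y)))
    have e₂ := hh i (α i (v i (g i y)))
    have e₃ := congrArg (dX i) (hv₂ i (g i y))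
    simp only [map_add, map_zero, hg] at e₁ e₂ e₃ ⊢
    grind
  have hwd : ∀ i (x : X (i + 1)), w (i + 1 + 1) (dX (i + 1) x + α (i + 1) x) =
      dX (i + 1) (w (i + 1) x) + α (i + 1) (v (i + 1) (g (i + 1) (f (i + 1) (w (i + 1) x)))) :=
    fun i x => by
    rw [← hwα, ← hu₁ (i + 1) (dX (i + 1) (w (i + 1) x)), ← map_add]
    congr 1
    have e₁ := hα i (h i (w (i + 1) x))
    have e₂ := congrArg (α (i + 1)) (hh i (w (i + 1) x))
    have e₃ := congrArg (dX (i + 1)) (hu₂ i x)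
    have e₄ := congrArg (α (i + 1)) (hu₂ i x)
    simp only [map_add, map_sub] at e₁ e₂ e₃ e₄ ⊢
    grind
  have hF : ∀ i (x : X i), dY i (f i (w i x)) + f (i + 1) (α i (v i (g i (f i (w i x))))) =
      f (i + 1) (w (i + 1) (dX i x + α i x)) := fun i x => by
    obtain ⟨j, rfl⟩ : ∃ j, i = j + 1 := ⟨i - 1, by omega⟩
    rw [hwd, map_add, hf]
  have hH : ∀ i (x : X (i + 1)), dX i (h i (w (i + 1) x)) + α i (h i (w (i + 1) x)) +
      h (i + 1) (w (i + 1 + 1) (dX (i + 1) x + α (i + 1) x)) =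
        x - v (i + 1) (g (i + 1) (f (i + 1) (w (i + 1) x))) := fun i x => by
    rw [hwd, map_add]
    have e₁ := hh i (w (i + 1) x)
    have e₂ := hu₂ i x
    have e₃ := hv₂ (i + 1) (g (i + 1) (f (i + 1) (w (i + 1) x)))
    grind
  refine ⟨fun i y => ?_, fun i => hF (i + 1), hG, hH, ?_⟩
  · have e₁ := congrArg (f (i + 1 + 1)) (hα i (v i (g i y)))
    have e₂ := congrArg (fun x => f (i + 1 + 1) (α (i + 1) x)) (hG i y)
    simp only [map_add, map_zero, hf] at e₁ e₂ ⊢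
    grind
  -- The cone of `G` is isomorphic to the cone of `g`; transporting a contraction of the latter
  -- yields a left homotopy inverse `F'` of `G`, with homotopy `L`.
  let β : ∀ i, Y i →ₗ[R] Y (i + 1) := fun i => f (i + 1) ∘ₗ α i ∘ₗ v i ∘ₗ g i
  let F : ∀ i, X i →ₗ[R] Y i := fun i => f i ∘ₗ w i
  let m : ∀ i, Y (i + 1) →ₗ[R] X i := fun i => g i ∘ₗ k i - h i ∘ₗ g (i + 1)
  let P : ∀ i, X (i + 1) →ₗ[R] Y i := fun i =>
    F i ∘ₗ h i - k i ∘ₗ f (i + 1) + F i ∘ₗ m i ∘ₗ f (i + 1)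
  let F' : ∀ i, X i →ₗ[R] Y i := fun i => F i + P i ∘ₗ α i
  let L : ∀ i, Y (i + 1) →ₗ[R] Y i := fun i => k i - F i ∘ₗ m i
  have hβ : ∀ i y, F (i + 1) (α i (g i y)) = β i y := fun i y => by
    simp [F, β, hwα]
  have hdF : ∀ i x, dY i (F i x) + β i (F i x) = F (i + 1) (dX i x) + F (i + 1) (α i x) :=
    fun i x => by simpa [F, β] using hF i x
  have hFαh : ∀ i x, F (i + 1) (α i (h i x)) = f (i + 1) x - F (i + 1) x := fun i x => by
    have e := congrArg (f (i + 1)) (hu₁ i x)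
    simp only [F, LinearMap.comp_apply, map_add] at e ⊢
    grind
  have hm : ∀ i y, dX i (m i y) + m (i + 1) (dY (i + 1) y) = 0 := fun i y => by
    have e₁ := congrArg (g (i + 1)) (hk i y)
    have e₂ := hh i (g (i + 1) y)
    simp only [m, LinearMap.sub_apply, LinearMap.comp_apply, map_add, map_sub, hg] at e₁ e₂ ⊢
    grind
  have hFαm : ∀ i y, F (i + 1) (α i (m i y)) =
      β i (k i y) - f (i + 1) (g (i + 1) y) + F (i + 1) (g (i + 1) y) := fun i y => by
    simp only [m, LinearMap.sub_apply, LinearMap.comp_apply, map_sub, hβ, hFαh]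
    abel
  have hP : ∀ i x, dY i (P i x) + β i (P i x) + P (i + 1) (dX (i + 1) x) = 0 := fun i x => by
    have e₁ := hdF i (h i x)
    have e₂ := hdF i (m i (f (i + 1) x))
    have e₃ := congrArg (F (i + 1)) (hh i x)
    have e₄ := congrArg (F (i + 1)) (hm i (f (i + 1) x))
    have e₅ := hk i (f (i + 1) x)
    have e₆ := hFαm i (f (i + 1) x)
    have e₇ := hFαh i x
    simp only [P, LinearMap.sub_apply, LinearMap.add_apply, LinearMap.comp_apply, map_add, map_sub,
      map_zero, hf] at e₁ e₂ e₃ e₄ e₅ e₆ e₇ ⊢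
    grind
  have hF' : ∀ i x, (dY i + β i) (F' i x) = F' (i + 1) ((dX i + α i) x) := fun i x => by
    have e₁ := hdF i x
    have e₂ := hP i (α i x)
    have e₃ := congrArg (P (i + 1)) (hα i x)
    simp only [F', LinearMap.add_apply, LinearMap.comp_apply, map_add, map_zero] at e₁ e₂ e₃ ⊢
    grind
  have hL : ∀ i y, (dY i + β i) (L i y) + L (i + 1) ((dY (i + 1) + β (i + 1)) y) =
      y - F' (i + 1) (v (i + 1) (g (i + 1) y)) := fun i y => by
    have e₁ := hdF i (m i y)
    have e₂ := hFαm i y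
    have e₃ := congrArg (F (i + 1)) (hm i y)
    have e₄ := hk i y
    have e₅ := congrArg (F (i + 1)) (hv₂ (i + 1) (g (i + 1) y))
    have e₆ : β (i + 1) y = f (i + 1 + 1) (α (i + 1) (v (i + 1) (g (i + 1) y))) := rfl
    simp only [F', L, P, LinearMap.sub_apply, LinearMap.add_apply, LinearMap.comp_apply, map_add,
      map_sub, map_zero, ← e₆] at e₁ e₂ e₃ e₄ e₅ ⊢
    grind
  exact ⟨fun i => L i ∘ₗ (LinearMap.id - F (i + 1) ∘ₗ v (i + 1) ∘ₗ g (i + 1)) +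
      F' i ∘ₗ h i ∘ₗ w (i + 1) ∘ₗ v (i + 1) ∘ₗ g (i + 1),
    homotopy_id_of_left_inverse (fun i => dX i + α i) (fun i => dY i + β i) F F'
      (fun i => v i ∘ₗ g i) hF hF' hG (fun i => h i ∘ₗ w (i + 1)) L hH hL⟩

end
end

section
/- (Parity for one-sided convolutions.) Let K be a field, m ≥ 1, and let F₁, …, F_m be cochain complexes of K-vector spaces. Let X be a cochain complex whose i-th term is the direct sum ⊕_{j=1}^{m} F_jⁱ and whose differential d has components d_{jk} : F_jⁱ → F_kⁱ⁺¹ satisfying: d_{jj} equals the differential of F_j, and d_{jk} = 0 whenever j < k (so the off-diagonal components of d strictly decrease the index). If Hⁱ(F_j) = 0 for every odd integer i and every j, then for every integer i there is an isomorphism of K-vector spaces Hⁱ(X) ≅ ⊕_{j=1}^{m} Hⁱ(F_j); in particular Hⁱ(X) = 0 for every odd i. -/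
noncomputable section

/-- The cohomology of a ℤ-indexed cochain complex `(M, d)` in degree `i + 1`:
`ker(d_{i+1}) / im(d_i)`.  (As `i` ranges over `ℤ`, this computes the cohomology in
every degree.) -/
abbrev cohomologyAt {R : Type*} [Ring R] {M : ℤ → Type*} [∀ i, AddCommGroup (M i)]
    [∀ i, Module R (M i)] (d : ∀ i : ℤ, M i →ₗ[R] M (i + 1)) (i : ℤ) :=
  LinearMap.ker (d (i + 1)) ⧸
    Submodule.comap (LinearMap.ker (d (i + 1))).subtype (LinearMap.range (d i))

section Auxiliary

theorem subsingleton_cohomologyAt_iff {R : Type*} [Ring R] {M : ℤ → Type*}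
    [∀ i, AddCommGroup (M i)] [∀ i, Module R (M i)] (d : ∀ i : ℤ, M i →ₗ[R] M (i + 1)) (i : ℤ) :
    Subsingleton (cohomologyAt d i) ↔ ∀ x, d (i + 1) x = 0 → ∃ y, d i y = x := by
  rw [Submodule.Quotient.subsingleton_iff, Submodule.comap_subtype_eq_top]
  exact Iff.rfl

variable {K : Type*} [Field K] {m : ℕ} {F : Fin m → ℤ → Type*} [∀ j i, AddCommGroup (F j i)]
  [∀ j i, Module K (F j i)]

/-- The submodule of families whose components of index at least `n` vanish. -/
def supportedBelow (K : Type*) [Field K] {m : ℕ} (E : Fin m → Type*) [∀ j, AddCommGroup (E j)]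
    [∀ j, Module K (E j)] (n : ℕ) : Submodule K (∀ j, E j) where
  carrier := {x | ∀ k : Fin m, n ≤ k → x k = 0}
  add_mem' hx hy k hk := by simp [hx k hk, hy k hk]
  zero_mem' _ _ := rfl
  smul_mem' c x hx k hk := by simp [hx k hk]

section SupportedBelow

variable {E : Fin m → Type*} [∀ j, AddCommGroup (E j)] [∀ j, Module K (E j)]

theorem mem_supportedBelow {n : ℕ} {x : ∀ j, E j} :
    x ∈ supportedBelow K E n ↔ ∀ k : Fin m, n ≤ k → x k = 0 := Iff.rfl

theorem supportedBelow_mono {a b : ℕ} (h : a ≤ b) :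
    supportedBelow K E a ≤ supportedBelow K E b :=
  fun _ hx k hk => hx k (h.trans hk)

theorem mem_supportedBelow_of_le {n : ℕ} (h : m ≤ n) (x : ∀ j, E j) :
    x ∈ supportedBelow K E n :=
  fun k hk => absurd k.isLt (by omega)

theorem mem_supportedBelow_of_succ {n : ℕ} {x : ∀ j, E j} (hx : x ∈ supportedBelow K E (n + 1))
    (h : ∀ k : Fin m, (k : ℕ) = n → x k = 0) : x ∈ supportedBelow K E n := by
  intro k hk
  rcases hk.eq_or_lt with e | e
  · exact h k e.symm
  · exact hx k e

theorem single_mem_supportedBelow (j : Fin m) (v : E j) :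
    Pi.single j v ∈ supportedBelow K E (j + 1) := by
  intro k hk
  exact Pi.single_eq_of_ne (by rintro rfl; omega) v

end SupportedBelow

/-- `D` is the differential of a one-sided convolution of the complexes `(F j, dF j)`. -/
structure IsOneSidedConvolution (dF : ∀ (j : Fin m) (i : ℤ), F j i →ₗ[K] F j (i + 1))
    (D : ∀ i : ℤ, (∀ j, F j i) →ₗ[K] ∀ j, F j (i + 1)) : Prop where
  d_comp_d : ∀ (i : ℤ) (x : ∀ j, F j i), D (i + 1) (D i x) = 0
  diag : ∀ (i : ℤ) (j : Fin m) (v : F j i), D i (Pi.single j v) j = dF j i v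
  triangular : ∀ (i : ℤ) (j k : Fin m), j < k → ∀ v : F j i, D i (Pi.single j v) k = 0

namespace IsOneSidedConvolution

variable {dF : ∀ (j : Fin m) (i : ℤ), F j i →ₗ[K] F j (i + 1)}
  {D : ∀ i : ℤ, (∀ j, F j i) →ₗ[K] ∀ j, F j (i + 1)}

theorem apply_eq_sum (i : ℤ) (x : ∀ j, F j i) (k : Fin m) :
    D i x k = ∑ j, D i (Pi.single j (x j)) k := by
  conv_lhs => rw [← Finset.univ_sum_single x]
  rw [map_sum, Finset.sum_apply]

theorem map_mem (h : IsOneSidedConvolution dF D) {i : ℤ} {n : ℕ} {x : ∀ j, F j i}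
    (hx : x ∈ supportedBelow K (F · i) n) : D i x ∈ supportedBelow K (F · (i + 1)) n := by
  intro k hk
  rw [apply_eq_sum]
  refine Finset.sum_eq_zero fun j _ => ?_
  by_cases hj : j < k
  · exact h.triangular i j k hj _
  · have hj' : (k : ℕ) ≤ j := not_lt.mp hj
    rw [hx j (hk.trans hj')]
    simp

theorem apply_top (h : IsOneSidedConvolution dF D) {i : ℤ} (k : Fin m) {x : ∀ j, F j i}
    (hx : x ∈ supportedBelow K (F · i) (k + 1)) : D i x k = dF k i (x k) := by
  rw [apply_eq_sum, Finset.sum_eq_single k, h.diag]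
  · intro j _ hj
    rcases lt_or_gt_of_ne hj with hj | hj
    · exact h.triangular i j k hj _
    · rw [hx j hj]
      simp
  · simp

theorem exists_preimage (h : IsOneSidedConvolution dF D) {i : ℤ}
    (hF : ∀ j x, dF j (i + 1) x = 0 → ∃ y, dF j i y = x) (n : ℕ) :
    ∀ x ∈ supportedBelow K (F · (i + 1)) n, D (i + 1) x = 0 →
      ∃ y ∈ supportedBelow K (F · i) n, D i y = x := by
  induction n with
  | zero =>
    intro x hx _
    exact ⟨0, zero_mem _, by rw [map_zero]; exact funext fun k => (hx k (Nat.zero_le _)).symm⟩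
  | succ n ih =>
    intro x hx hDx
    by_cases hn : n < m
    · let k : Fin m := ⟨n, hn⟩
      obtain ⟨v, hv⟩ := hF k (x k) (by rw [← h.apply_top k hx, hDx]; rfl)
      have hs := single_mem_supportedBelow (K := K) (E := (F · i)) k v
      obtain ⟨y, hy, hDy⟩ := ih (x - D i (Pi.single k v))
        (mem_supportedBelow_of_succ (sub_mem hx (h.map_mem hs)) fun k' hk' => by
          obtain rfl : k' = k := Fin.ext hk'
          rw [Pi.sub_apply, h.diag, hv, sub_self])
        (by rw [map_sub, hDx, h.d_comp_d, sub_zero])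
      exact ⟨y + Pi.single k v, add_mem (supportedBelow_mono n.le_succ hy) hs,
        by rw [map_add, hDy, sub_add_cancel]⟩
    · obtain ⟨y, hy, hDy⟩ := ih x (mem_supportedBelow_of_le (not_lt.mp hn) x) hDx
      exact ⟨y, supportedBelow_mono n.le_succ hy, hDy⟩

/-- If the `F j` are exact in degree `i + 1`, then the differential out of that degree is strict
for the filtration by support. -/
theorem exists_mem_apply_eq (h : IsOneSidedConvolution dF D) {i : ℤ}
    (hF : ∀ j x, dF j (i + 1) x = 0 → ∃ y, dF j i y = x) (n t : ℕ) :
    ∀ y ∈ supportedBelow K (F · (i + 1)) (n + t),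
      D (i + 1) y ∈ supportedBelow K (F · (i + 1 + 1)) n →
      ∃ y' ∈ supportedBelow K (F · (i + 1)) n, D (i + 1) y' = D (i + 1) y := by
  induction t with
  | zero => exact fun y hy _ => ⟨y, hy, rfl⟩
  | succ t ih =>
    intro y hy hDy
    by_cases hn : n + t < m
    · let k : Fin m := ⟨n + t, hn⟩
      obtain ⟨v, hv⟩ := hF k (y k) (by
        rw [← h.apply_top k hy]
        exact hDy k (Nat.le_add_right n t))
      have hs := single_mem_supportedBelow (K := K) (E := (F · i)) k v
      have hD : D (i + 1) (y - D i (Pi.single k v)) = D (i + 1) y := by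
        rw [map_sub, h.d_comp_d, sub_zero]
      obtain ⟨y', hy', hDy'⟩ := ih (y - D i (Pi.single k v))
        (mem_supportedBelow_of_succ (sub_mem hy (h.map_mem hs)) fun k' hk' => by
          obtain rfl : k' = k := Fin.ext hk'
          rw [Pi.sub_apply, h.diag, hv, sub_self])
        (by rwa [hD])
      exact ⟨y', hy', hDy'.trans hD⟩
    · exact ih y (mem_supportedBelow_of_le (not_lt.mp hn) y) hDy

theorem exists_cocycle_lift (h : IsOneSidedConvolution dF D) {i : ℤ}
    (hF : ∀ j x, dF j (i + 1) x = 0 → ∃ y, dF j i y = x) (j : Fin m) (z : F j i)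
    (hz : dF j i z = 0) :
    ∃ x ∈ supportedBelow K (F · i) (j + 1), D i x = 0 ∧ x j = z := by
  have hs := single_mem_supportedBelow (K := K) (E := (F · i)) j z
  obtain ⟨u, hu, hDu⟩ := h.exists_preimage hF j (D i (Pi.single j z))
    (mem_supportedBelow_of_succ (h.map_mem hs) fun k' hk' => by
      obtain rfl : k' = j := Fin.ext hk'
      rw [h.diag, hz]) (h.d_comp_d i _)
  refine ⟨Pi.single j z - u, sub_mem hs (supportedBelow_mono (Nat.le_succ _) hu), ?_, ?_⟩
  · rw [map_sub, hDu, sub_self]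
  · rw [Pi.sub_apply, hu j le_rfl, Pi.single_eq_same, sub_zero]

/-- The map sending a cocycle of the convolution supported in indices at most `j` to the class
of its component of index `j`. -/
def topClass (h : IsOneSidedConvolution dF D) (i : ℤ) (j : Fin m) :
    ↥(LinearMap.ker (D (i + 1)) ⊓ supportedBelow K (F · (i + 1)) (j + 1)) →ₗ[K]
      cohomologyAt (dF j) i :=
  (Submodule.mkQ _).comp <| LinearMap.codRestrict (LinearMap.ker (dF j (i + 1)))
    ((LinearMap.proj j).comp (Submodule.subtype _)) fun x => by
      rw [LinearMap.mem_ker, LinearMap.comp_apply, LinearMap.proj_apply]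
      exact (h.apply_top j x.2.2).symm.trans (congrFun x.2.1 j)

theorem topClass_eq_zero_iff (h : IsOneSidedConvolution dF D) {i : ℤ} {j : Fin m}
    (x : ↥(LinearMap.ker (D (i + 1)) ⊓ supportedBelow K (F · (i + 1)) (j + 1))) :
    h.topClass i j x = 0 ↔ ∃ y, dF j i y = x.1 j :=
  Submodule.Quotient.mk_eq_zero _

theorem topClass_surjective (h : IsOneSidedConvolution dF D) {i : ℤ}
    (hF : ∀ j x, dF j (i + 1 + 1) x = 0 → ∃ y, dF j (i + 1) y = x) (j : Fin m) :
    Function.Surjective (h.topClass i j) := by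
  intro c
  obtain ⟨⟨z, hz⟩, rfl⟩ := Submodule.mkQ_surjective _ c
  obtain ⟨x, hx, hDx, rfl⟩ := h.exists_cocycle_lift hF j z hz
  exact ⟨⟨x, hDx, hx⟩, rfl⟩

/-- If the `F j` are exact in the two degrees adjacent to `i + 2`, the cohomology of the
convolution in degree `i + 2` is the product of the cohomologies of the `F j`. -/
theorem nonempty_cohomologyAt_equiv (h : IsOneSidedConvolution dF D) {i : ℤ}
    (hF : ∀ j x, dF j (i + 1) x = 0 → ∃ y, dF j i y = x)
    (hF' : ∀ j x, dF j (i + 1 + 1 + 1) x = 0 → ∃ y, dF j (i + 1 + 1) y = x) :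
    Nonempty ((cohomologyAt (M := fun i => ∀ j, F j i) D (i + 1)) ≃ₗ[K]
      (∀ j, cohomologyAt (dF j) (i + 1))) := by
  choose s hs using fun j => LinearMap.exists_rightInverse_of_surjective (h.topClass (i + 1) j)
    (LinearMap.range_eq_top.mpr (h.topClass_surjective hF' j))
  replace hs : ∀ j c, h.topClass (i + 1) j (s j c) = c := fun j c => LinearMap.congr_fun (hs j) c
  let τ : (∀ j, cohomologyAt (dF j) (i + 1)) →ₗ[K] LinearMap.ker (D (i + 1 + 1)) :=
    ∑ j, (Submodule.inclusion inf_le_left).comp ((s j).comp (LinearMap.proj j))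
  have τ_apply (c) : (τ c : ∀ j, F j (i + 1 + 1)) = ∑ j, (s j (c j)).1 := by
    simp [τ, LinearMap.sum_apply]
  have τ_single (j c) : (τ (Pi.single j c) : ∀ j, F j (i + 1 + 1)) = (s j c).1 := by
    rw [τ_apply, Finset.sum_eq_single j, Pi.single_eq_same]
    · intro k _ hk
      rw [Pi.single_eq_of_ne hk, map_zero, Submodule.coe_zero]
    · simp
  have surj (n : ℕ) : ∀ x ∈ supportedBelow K (F · (i + 1 + 1)) n, D (i + 1 + 1) x = 0 →
      ∃ c y, x = τ c + D (i + 1) y := by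
    induction n with
    | zero =>
      intro x hx _
      refine ⟨0, 0, ?_⟩
      rw [map_zero, map_zero, Submodule.coe_zero, add_zero]
      exact funext fun k => hx k (Nat.zero_le _)
    | succ n ih =>
      intro x hx hDx
      by_cases hn : n < m
      · let k : Fin m := ⟨n, hn⟩
        let c := h.topClass (i + 1) k ⟨x, hDx, hx⟩
        obtain ⟨v, hv⟩ := (h.topClass_eq_zero_iff (⟨x, hDx, hx⟩ - s k c)).mp
          (by rw [map_sub, hs, sub_self])
        have hv' : dF k (i + 1) v = x k - (s k c).1 k := hv
        have hsv := single_mem_supportedBelow (K := K) (E := (F · (i + 1))) k v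
        obtain ⟨c', y, hy⟩ := ih (x - (s k c).1 - D (i + 1) (Pi.single k v))
          (mem_supportedBelow_of_succ (sub_mem (sub_mem hx (s k c).2.2) (h.map_mem hsv))
            fun k' hk' => by
              obtain rfl : k' = k := Fin.ext hk'
              rw [Pi.sub_apply, Pi.sub_apply, h.diag, hv', sub_self])
          (by rw [map_sub, map_sub, hDx, h.d_comp_d, LinearMap.mem_ker.mp (s k c).2.1]; simp)
        refine ⟨c' + Pi.single k c, y + Pi.single k v, ?_⟩
        rw [map_add, map_add, Submodule.coe_add, τ_single, add_add_add_comm, ← sub_eq_iff_eq_add, ← hy]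
        abel
      · exact ih x (mem_supportedBelow_of_le (not_lt.mp hn) x) hDx
  have inj (c y) (hcy : (τ c : ∀ j, F j (i + 1 + 1)) = D (i + 1) y) (t : ℕ) :
      ∀ k : Fin m, m ≤ k + t → c k = 0 := by
    induction t with
    | zero => exact fun k hk => absurd k.isLt (by omega)
    | succ t ih =>
      intro k hk
      have hsup (j : Fin m) :
          (s j (c j)).1 ∈ supportedBelow K (F · (i + 1 + 1)) (k + 1) := by
        by_cases hj : j ≤ k
        · exact supportedBelow_mono (Nat.succ_le_succ hj) (s j (c j)).2.2
        · rw [ih j (by have : (k : ℕ) < j := not_le.mp hj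
                       omega), map_zero]
          exact zero_mem _
      have hτ : (τ c : ∀ j, F j (i + 1 + 1)) ∈ supportedBelow K (F · (i + 1 + 1)) (k + 1) := by
        rw [τ_apply]
        exact sum_mem fun j _ => hsup j
      obtain ⟨y', hy', hDy'⟩ := h.exists_mem_apply_eq hF (k + 1) m y
        (mem_supportedBelow_of_le (by omega) y) (hcy ▸ hτ)
      rw [← hs k (c k), h.topClass_eq_zero_iff]
      refine ⟨y' k, ?_⟩
      rw [← h.apply_top k hy', hDy', ← hcy, τ_apply, Finset.sum_apply, Finset.sum_eq_single k]
      · intro j _ hj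
        rcases lt_or_gt_of_ne hj with hj | hj
        · exact (s j (c j)).2.2 k hj
        · rw [ih j (by have : (k : ℕ) < j := hj
                       omega), map_zero]
          rfl
      · simp
  refine ⟨(LinearEquiv.ofBijective ((Submodule.mkQ _).comp τ) ⟨?_, ?_⟩).symm⟩
  · rw [← LinearMap.ker_eq_bot, LinearMap.ker_eq_bot']
    intro c hc
    obtain ⟨y, hy⟩ := (Submodule.Quotient.mk_eq_zero _).mp hc
    exact funext fun k => inj c y hy.symm m k (Nat.le_add_left _ _)
  · intro q
    obtain ⟨⟨x, hx⟩, rfl⟩ := Submodule.mkQ_surjective _ q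
    obtain ⟨c, y, hxy⟩ := surj m x (mem_supportedBelow_of_le le_rfl x) hx
    have hq : (⟨x, hx⟩ - τ c : LinearMap.ker (D (i + 1 + 1))) ∈
        (LinearMap.range (D (i + 1))).comap (LinearMap.ker (D (i + 1 + 1))).subtype :=
      ⟨y, eq_sub_of_add_eq' hxy.symm⟩
    exact ⟨c, ((Submodule.Quotient.eq _).mpr hq).symm⟩

end IsOneSidedConvolution

end Auxiliary

/-- **Parity for one-sided convolutions.**  If `X` is a one-sided convolution of the
cochain complexes `F₁, …, F_m` of `K`-vector spaces (the `i`-th term of `X` is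
`⊕_j F_jⁱ`, the diagonal components of its differential are the differentials of the
`F_j`, and the off-diagonal components strictly decrease the index `j`), and each
`F_j` has vanishing cohomology in all odd degrees, then `Hⁱ(X) ≅ ⊕_j Hⁱ(F_j)` for all
`i`; in particular `Hⁱ(X) = 0` for all odd `i`. -/
theorem parity_one_sided_convolution {K : Type*} [Field K] (m : ℕ) (hm : 1 ≤ m)
    (F : Fin m → ℤ → Type*) [∀ j i, AddCommGroup (F j i)] [∀ j i, Module K (F j i)]
    (dF : ∀ (j : Fin m) (i : ℤ), F j i →ₗ[K] F j (i + 1))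
    (hdF : ∀ (j : Fin m) (i : ℤ) (v : F j i), dF j (i + 1) (dF j i v) = 0)
    (D : ∀ i : ℤ, (∀ j, F j i) →ₗ[K] ∀ j, F j (i + 1))
    (hD : ∀ (i : ℤ) (x : ∀ j, F j i), D (i + 1) (D i x) = 0)
    (hdiag : ∀ (i : ℤ) (j : Fin m) (v : F j i), D i (Pi.single j v) j = dF j i v)
    (htri : ∀ (i : ℤ) (j k : Fin m), j < k → ∀ v : F j i, D i (Pi.single j v) k = 0)
    (hodd : ∀ (j : Fin m) (i : ℤ), Odd (i + 1) → Subsingleton (cohomologyAt (dF j) i)) :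
    (∀ i : ℤ, Nonempty
      ((cohomologyAt (M := fun i => ∀ j, F j i) D i) ≃ₗ[K]
        (∀ j, cohomologyAt (dF j) i))) ∧
    (∀ i : ℤ, Odd (i + 1) →
      Subsingleton (cohomologyAt (M := fun i => ∀ j, F j i) D i)) := by
  have h : IsOneSidedConvolution dF D := ⟨hD, hdiag, htri⟩
  have hF (i : ℤ) (hi : Odd (i + 1)) (j) := (subsingleton_cohomologyAt_iff _ _).mp (hodd j i hi)
  have hX (i : ℤ) (hi : Odd (i + 1)) :
      Subsingleton (cohomologyAt (M := fun i => ∀ j, F j i) D i) := by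
    refine (subsingleton_cohomologyAt_iff (M := fun i => ∀ j, F j i) D i).mpr fun x hx => ?_
    obtain ⟨y, -, hy⟩ := h.exists_preimage (hF i hi) m x (mem_supportedBelow_of_le le_rfl x) hx
    exact ⟨y, hy⟩
  refine ⟨fun i => ?_, hX⟩
  by_cases hi : Odd (i + 1)
  · have := hX i hi
    have := fun j => hodd j i hi
    exact ⟨0⟩
  · obtain ⟨i, rfl⟩ : ∃ i', i = i' + 1 := ⟨i - 1, by ring⟩
    rw [Int.not_odd_iff_even] at hi
    have hi' : Odd (i + 1) := by
      rw [← Int.not_even_iff_odd]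
      exact Int.even_add_one.mp hi
    exact h.nonempty_cohomologyAt_equiv (hF i hi') (hF (i + 1 + 1) hi.add_one)

end
end

section
/- Let R be a commutative ring, n ≥ 2, and fix i with 1 ≤ i ≤ n−1. Let σ be the R-algebra automorphism of the polynomial ring R[x₁, …, xₙ] that interchanges xᵢ and xᵢ₊₁ and fixes all other variables, and let B ⊆ R[x₁, …, xₙ] be the subalgebra of polynomials fixed by σ. Then R[x₁, …, xₙ] is a free B-module of rank 2 with basis {1, xᵢ}: every polynomial f can be written uniquely as f = p + q·xᵢ with p, q ∈ B. (This freeness underlies the fact that the Bott–Samelson bimodule Bᵢ = R[x₁,…,xₙ] ⊗_B R[x₁,…,xₙ], and hence every Soergel bimodule, is projective as a left or right R[x₁,…,xₙ]-module.) -/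
namespace MvPolynomial

variable {R ι : Type*} [CommRing R]

/-- The difference of two distinct variables is not a zero divisor. -/
theorem eq_zero_of_mul_X_sub_X_eq_zero {a b : ι} (hab : a ≠ b) {r : MvPolynomial ι R}
    (h : r * (X a - X b) = 0) : r = 0 := by
  classical
  let φ : MvPolynomial ι R →ₐ[R] MvPolynomial ι R :=
    aeval fun j => if j = a then X a + X b else X j
  let ψ : MvPolynomial ι R →ₐ[R] MvPolynomial ι R :=
    aeval fun j => if j = a then X a - X b else X j
  have hψφ : ψ.comp φ = AlgHom.id R _ := by
    ext1 j
    by_cases hj : j = a <;> simp [φ, ψ, hj, hab.symm]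
  have hφ : φ r * X a = 0 := by
    simpa [φ, hab.symm] using congrArg φ h
  have hr : φ r = 0 := (isRegular_X (n := a)).right (hφ.trans (zero_mul _).symm)
  simpa [hr] using (DFunLike.congr_fun hψφ r).symm

/-- Every polynomial is of the form `p + q * X a` with `p` and `q` invariant under the
transposition of the variables `a` and `b`. -/
theorem exists_eq_add_mul_X_of_swap [DecidableEq ι] {a b : ι} (f : MvPolynomial ι R) :
    ∃ p q : MvPolynomial ι R, rename (Equiv.swap a b) p = p ∧
      rename (Equiv.swap a b) q = q ∧ p + q * X a = f := by
  induction f using MvPolynomial.induction_on with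
  | C r => exact ⟨C r, 0, by simp, by simp, by simp⟩
  | add f g hf hg =>
    obtain ⟨p, q, hp, hq, rfl⟩ := hf
    obtain ⟨p', q', hp', hq', rfl⟩ := hg
    exact ⟨p + p', q + q', by simp [hp, hp'], by simp [hq, hq'], by ring⟩
  | mul_X f j hf =>
    obtain ⟨p, q, hp, hq, rfl⟩ := hf
    by_cases hja : j = a
    · subst hja
      exact ⟨-(q * (X j * X b)), p + q * (X j + X b), by simp [hq, mul_comm (X b)],
        by simp [hp, hq, add_comm (X b)], by ring⟩
    by_cases hjb : j = b
    · subst hjb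
      exact ⟨p * (X a + X j) + q * (X a * X j), -p,
        by simp [hp, hq, add_comm (X j), mul_comm (X j)], by simp [hp], by ring⟩
    have hj : Equiv.swap a b j = j := Equiv.swap_apply_of_ne_of_ne hja hjb
    exact ⟨p * X j, q * X j, by simp [hp, hj], by simp [hq, hj], by ring⟩

end MvPolynomial

/-- Let `σ` be the automorphism of `R[x₁, …, xₙ]` interchanging `xᵢ` and `xᵢ₊₁`
(variables are indexed by `Fin n`, with `xᵢ` the variable of index `i - 1`), and let
`B` be its fixed subalgebra.  Then `R[x₁, …, xₙ]` is a free `B`-module of rank 2 with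
basis `{1, xᵢ}`: the `B`-module map `B² → R[x₁, …, xₙ]`, `(p, q) ↦ p + q·xᵢ`, is
bijective. -/
theorem mvPolynomial_free_over_transposition_invariants
    {R : Type*} [CommRing R] (n : ℕ) (hn : 2 ≤ n) (i : ℕ) (h1 : 1 ≤ i) (h2 : i ≤ n - 1) :
    let a : Fin n := ⟨i - 1, by omega⟩
    let b : Fin n := ⟨i, by omega⟩
    let σ := MvPolynomial.renameEquiv R (Equiv.swap a b)
    let B := AlgHom.equalizer σ.toAlgHom (AlgHom.id R (MvPolynomial (Fin n) R))
    Function.Bijective (fun pq : ↥B × ↥B =>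
      (pq.1 : MvPolynomial (Fin n) R) + (pq.2 : MvPolynomial (Fin n) R) *
        MvPolynomial.X a) := by
  intro a b σ B
  have hab : a ≠ b := by
    simp only [a, b, ne_eq, Fin.mk.injEq]
    omega
  have hσ (p : B) : MvPolynomial.rename (Equiv.swap a b) (p : MvPolynomial (Fin n) R) = p := p.2
  constructor
  · rintro ⟨p, q⟩ ⟨p', q'⟩ h
    dsimp only at h
    have h_swap := congrArg (MvPolynomial.rename (Equiv.swap a b)) h
    simp only [map_add, map_mul, hσ, MvPolynomial.rename_X, Equiv.swap_apply_left] at h_swap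
    have hq : (q : MvPolynomial (Fin n) R) = q' := sub_eq_zero.mp <|
      MvPolynomial.eq_zero_of_mul_X_sub_X_eq_zero hab (by linear_combination h - h_swap)
    have hp : (p : MvPolynomial (Fin n) R) = p' := by
      rw [hq] at h
      exact add_right_cancel h
    exact Prod.ext (Subtype.ext hp) (Subtype.ext hq)
  · intro f
    obtain ⟨p, q, hp, hq, hf⟩ := MvPolynomial.exists_eq_add_mul_X_of_swap (a := a) (b := b) f
    exact ⟨(⟨p, hp⟩, ⟨q, hq⟩), hf⟩
end
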